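/- The kernel of the partial-consensus matrix K_n, i.e. the subspace {x ∈ ℝ^{N̄} : K_n x = 0}, has dimension N̄ − nN + n. -/

import Mathlib

/-- The partial-consensus matrix `K_n`, acting on the stacked space
`ℝ^{N̄} ≅ {(i, p) : i ∈ Fin N, p ∈ Fin (nn i)} → ℝ` (coordinate `o i + p` of a stacked
vector corresponds to the pair `(i, p)`):  `(K_n)_{(i,p),(j,q)} = L i j` if `p = q < n`,
and `0` otherwise. -/
def partialConsensusMatrix (N : ℕ) (nn : Fin N → ℕ) (n : ℕ)
    (L : Matrix (Fin N) (Fin N) ℝ) :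
    Matrix ((i : Fin N) × Fin (nn i)) ((i : Fin N) × Fin (nn i)) ℝ :=
  fun a b => if (a.2 : ℕ) = (b.2 : ℕ) ∧ (a.2 : ℕ) < n then L a.1 b.1 else 0

open Matrix in
/-- On the `p`-th coordinates, `p < n`, the partial-consensus matrix acts as `L`. -/
theorem partialConsensusMatrix_mulVec_of_lt {N : ℕ} {nn : Fin N → ℕ} {n : ℕ}
    (hle : ∀ i, n ≤ nn i) (L : Matrix (Fin N) (Fin N) ℝ)
    (x : ((i : Fin N) × Fin (nn i)) → ℝ) (a : (i : Fin N) × Fin (nn i)) (ha : (a.2 : ℕ) < n) :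
    (partialConsensusMatrix N nn n L *ᵥ x) a =
      (L *ᵥ fun j => x ⟨j, ⟨a.2, ha.trans_le (hle j)⟩⟩) a.1 := by
  simp only [mulVec, dotProduct, partialConsensusMatrix, Fintype.sum_sigma]
  refine Finset.sum_congr rfl fun j _ => ?_
  rw [Finset.sum_eq_single ⟨a.2, ha.trans_le (hle j)⟩]
  · simp [ha]
  · intro q _ hq
    rw [if_neg, zero_mul]
    rintro ⟨h, -⟩
    exact hq (Fin.ext h.symm)
  · simp

open Matrix in
/-- The partial-consensus matrix annihilates the coordinates of index at least `n`. -/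
theorem partialConsensusMatrix_mulVec_of_le {N : ℕ} {nn : Fin N → ℕ} {n : ℕ}
    (L : Matrix (Fin N) (Fin N) ℝ)
    (x : ((i : Fin N) × Fin (nn i)) → ℝ) (a : (i : Fin N) × Fin (nn i)) (ha : n ≤ (a.2 : ℕ)) :
    (partialConsensusMatrix N nn n L *ᵥ x) a = 0 := by
  simp [mulVec, dotProduct, partialConsensusMatrix, ha.not_gt]

open Matrix in
/-- For a connected graph, the kernel of the partial-consensus matrix consists of the vectors
whose first `n` coordinates agree across all blocks. -/
theorem partialConsensusMatrix_lapMatrix_mulVec_eq_zero_iff {N : ℕ} {nn : Fin N → ℕ} {n : ℕ}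
    (hle : ∀ i, n ≤ nn i) {G : SimpleGraph (Fin N)} [DecidableRel G.Adj] (hG : G.Connected)
    (x : ((i : Fin N) × Fin (nn i)) → ℝ) :
    partialConsensusMatrix N nn n (G.lapMatrix ℝ) *ᵥ x = 0 ↔
      ∀ (p : ℕ) (hp : p < n) (i j : Fin N),
        x ⟨i, ⟨p, hp.trans_le (hle i)⟩⟩ = x ⟨j, ⟨p, hp.trans_le (hle j)⟩⟩ := by
  constructor
  · intro h p hp i j
    refine (G.lapMatrix_mulVec_eq_zero_iff_forall_reachable
      (x := fun j => x ⟨j, ⟨p, hp.trans_le (hle j)⟩⟩)).1 ?_ i j (hG.preconnected i j)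
    ext k
    rw [← partialConsensusMatrix_mulVec_of_lt hle _ x ⟨k, ⟨p, hp.trans_le (hle k)⟩⟩ hp, h]
    rfl
  · intro h
    ext a
    rcases lt_or_ge (a.2 : ℕ) n with ha | ha
    · rw [partialConsensusMatrix_mulVec_of_lt hle _ x a ha,
        G.lapMatrix_mulVec_eq_zero_iff_forall_reachable.2 fun i j _ => h a.2 ha i j]
      rfl
    · exact partialConsensusMatrix_mulVec_of_le _ x a ha

/-- The quotient of the stacked index set that identifies the `p`-th coordinates of all blocks
for each `p < n`. -/
def consensusIndex {N : ℕ} (nn : Fin N → ℕ) (n : ℕ) (a : (i : Fin N) × Fin (nn i)) :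
    Fin n ⊕ ((i : Fin N) × Fin (nn i - n)) :=
  if h : (a.2 : ℕ) < n then Sum.inl ⟨a.2, h⟩ else Sum.inr ⟨a.1, ⟨a.2 - n, by omega⟩⟩

theorem consensusIndex_surjective {N : ℕ} (hN : 1 ≤ N) {nn : Fin N → ℕ} {n : ℕ}
    (hle : ∀ i, n ≤ nn i) : Function.Surjective (consensusIndex nn n) := by
  rintro (p | ⟨i, q⟩)
  · exact ⟨⟨⟨0, hN⟩, ⟨p, p.2.trans_le (hle _)⟩⟩, by simp [consensusIndex]⟩
  · exact ⟨⟨i, ⟨q + n, by omega⟩⟩, by simp [consensusIndex]⟩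

theorem eq_of_consensusIndex_eq {N : ℕ} {nn : Fin N → ℕ} {n : ℕ} (hle : ∀ i, n ≤ nn i)
    {x : ((i : Fin N) × Fin (nn i)) → ℝ}
    (hx : ∀ (p : ℕ) (hp : p < n) (i j : Fin N),
      x ⟨i, ⟨p, hp.trans_le (hle i)⟩⟩ = x ⟨j, ⟨p, hp.trans_le (hle j)⟩⟩)
    {a b : (i : Fin N) × Fin (nn i)} (hab : consensusIndex nn n a = consensusIndex nn n b) :
    x a = x b := by
  obtain ⟨i, p, hp⟩ := a
  obtain ⟨j, q, hq⟩ := b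
  by_cases h₁ : p < n <;> by_cases h₂ : q < n <;> simp [consensusIndex, h₁, h₂] at hab
  · subst hab
    exact hx p h₁ i j
  · obtain ⟨rfl, h⟩ := hab
    obtain rfl : p = q := by
      have := Fin.mk.inj (eq_of_heq h)
      omega
    rfl

theorem ker_partialConsensusMatrix_lapMatrix {N : ℕ} (hN : 1 ≤ N) {nn : Fin N → ℕ} {n : ℕ}
    (hle : ∀ i, n ≤ nn i) {G : SimpleGraph (Fin N)} [DecidableRel G.Adj] (hG : G.Connected) :
    LinearMap.ker (partialConsensusMatrix N nn n (G.lapMatrix ℝ)).mulVecLin =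
      LinearMap.range (LinearMap.funLeft ℝ ℝ (consensusIndex nn n)) := by
  ext x
  rw [LinearMap.mem_ker, Matrix.mulVecLin_apply,
    partialConsensusMatrix_lapMatrix_mulVec_eq_zero_iff hle hG]
  constructor
  · intro hx
    have hs := consensusIndex_surjective hN hle
    exact ⟨x ∘ Function.surjInv hs, funext fun a =>
      eq_of_consensusIndex_eq hle hx (Function.surjInv_eq hs _)⟩
  · rintro ⟨y, rfl⟩ p hp i j
    simp [LinearMap.funLeft_apply, consensusIndex, hp]

/-- For the partial-consensus matrix built from the Laplacian of a
connected graph on `N` vertices, the kernel `{x : K_n x = 0}` has dimension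
`N̄ - n·N + n`. -/
theorem stmt4 (N : ℕ) (hN : 1 ≤ N) (nn : Fin N → ℕ) (hnn : ∀ i, 1 ≤ nn i)
    (n : ℕ) (hn : 1 ≤ n) (hle : ∀ i, n ≤ nn i)
    (G : SimpleGraph (Fin N)) [DecidableRel G.Adj] (hG : G.Connected) :
    Module.finrank ℝ
        (LinearMap.ker (partialConsensusMatrix N nn n (G.lapMatrix ℝ)).mulVecLin) =
      (∑ i, nn i) - n * N + n := by
  rw [ker_partialConsensusMatrix_lapMatrix hN hle hG, LinearMap.finrank_range_of_inj
    (LinearMap.funLeft_injective_of_surjective ℝ ℝ _ (consensusIndex_surjective hN hle)),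
    Module.finrank_fintype_fun_eq_card, Fintype.card_sum, Fintype.card_sigma]
  simp only [Fintype.card_fin]
  rw [Finset.sum_tsub_distrib _ fun i _ => hle i, add_comm, Finset.sum_const, Finset.card_univ,
    Fintype.card_fin, smul_eq_mul, mul_comm]
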